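/- arXiv:1504.02451 — 2 statements merged into one kernel-verified Lean document; each statement's English description precedes it below -/
import Mathlib

section
/- Let (φ,η,ξ,g) be a cosymplectic structure on a manifold M^{2n+1} with Kähler form ω (so dη = 0 = dω and L_ξ η = 0 = L_ξ ω). For each 0 ≤ k ≤ n, the Lefschetz map α ↦ ω^{n-k+1} ∧ ι_ξ α + ω^{n-k} ∧ η ∧ α restricts to a map L^{n-k}: Ω^k_ξ(M) → Ω^{2n+1-k}_ξ(M) on ξ-invariant forms, and this restricted map sends closed forms to closed forms. -/
noncomputable section

/-- A graded-commutative differential graded algebra over `ℝ` (a cdga), such as the de Rham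
algebra `Ω^*(M)` of a smooth manifold with the exterior derivative and the wedge product:
a graded `ℝ`-algebra with a degree `+1` differential squaring to zero and satisfying the
graded Leibniz rule, whose product is commutative in the graded sense. -/
structure CDGA where
  carrier : Type
  [ring : Ring carrier]
  [algebra : Algebra ℝ carrier]
  grading : ℕ → Submodule ℝ carrier
  [gradedAlgebra : GradedAlgebra grading]
  gcomm : ∀ {i j : ℕ} {a b : carrier}, a ∈ grading i → b ∈ grading j →
    a * b = ((-1 : ℝ) ^ (i * j)) • (b * a)
  d : carrier →ₗ[ℝ] carrier
  d_d : ∀ a : carrier, d (d a) = 0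
  d_mem : ∀ {i : ℕ} {a : carrier}, a ∈ grading i → d a ∈ grading (i + 1)
  leibniz : ∀ {i : ℕ} {a : carrier}, a ∈ grading i → ∀ b : carrier,
    d (a * b) = d a * b + ((-1 : ℝ) ^ i) • (a * d b)

attribute [instance] CDGA.ring CDGA.algebra CDGA.gradedAlgebra

namespace CDGA

variable (A : CDGA)

/-- The closed elements (cocycles) of degree `k`. -/
def cocycles (k : ℕ) : Submodule ℝ A.carrier :=
  A.grading k ⊓ LinearMap.ker A.d

/-- The exact elements (coboundaries) of degree `k`; there are none in degree `0`. -/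
def coboundaries : ℕ → Submodule ℝ A.carrier
  | 0 => ⊥
  | k + 1 => Submodule.map A.d (A.grading k) ⊓ A.grading (k + 1)

/-- The degree-`k` cohomology of the cdga (for the de Rham algebra of a manifold `M`,
this is the de Rham cohomology `H^k(M; ℝ)`). -/
def H (k : ℕ) : Type :=
  A.cocycles k ⧸ ((A.coboundaries k).comap (A.cocycles k).subtype)

instance (k : ℕ) : AddCommGroup (A.H k) :=
  inferInstanceAs (AddCommGroup
    (A.cocycles k ⧸ ((A.coboundaries k).comap (A.cocycles k).subtype)))

instance (k : ℕ) : Module ℝ (A.H k) :=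
  inferInstanceAs (Module ℝ
    (A.cocycles k ⧸ ((A.coboundaries k).comap (A.cocycles k).subtype)))

/-- The `k`-th Betti number: the dimension of the degree-`k` cohomology. -/
def betti (k : ℕ) : ℕ := Module.finrank ℝ (A.H k)

/-- `A.MulBijOn c k l` says that multiplication by the closed element `c` (of degree `l - k`)
induces a bijection (an isomorphism) `H^k(A) → H^l(A)` on cohomology: it is injective and
surjective at the level of classes. -/
def MulBijOn (c : A.carrier) (k l : ℕ) : Prop :=
  (∀ a ∈ A.cocycles k, c * a ∈ A.coboundaries l → a ∈ A.coboundaries k) ∧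
  (∀ b ∈ A.cocycles l, ∃ a ∈ A.cocycles k, c * a - b ∈ A.coboundaries l)

end CDGA

/-- A morphism of cdga's: an `ℝ`-algebra map preserving degrees and commuting with the
differentials. -/
structure CDGAHom (A B : CDGA) where
  toHom : A.carrier →ₐ[ℝ] B.carrier
  map_grading : ∀ i : ℕ, ∀ a ∈ A.grading i, toHom a ∈ B.grading i
  map_d : ∀ a : A.carrier, toHom (A.d a) = B.d (toHom a)

/-- A morphism of cdga's is a quasi-isomorphism if it induces an isomorphism on cohomology
in every degree (stated elementwise: injectivity and surjectivity on classes). -/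
def CDGAHom.IsQuasiIso {A B : CDGA} (f : CDGAHom A B) : Prop :=
  ∀ k : ℕ,
    (∀ a ∈ A.cocycles k, f.toHom a ∈ B.coboundaries k → a ∈ A.coboundaries k) ∧
    (∀ b ∈ B.cocycles k, ∃ a ∈ A.cocycles k, f.toHom a - b ∈ B.coboundaries k)

/-- Two cdga's are elementarily weakly equivalent if there is a quasi-isomorphism from one
to the other. -/
def QuasiIsoRel (A B : CDGA) : Prop := ∃ f : CDGAHom A B, f.IsQuasiIso

/-- Weak equivalence of cdga's: a zig-zag of quasi-isomorphisms. -/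
def WeakEquiv : CDGA → CDGA → Prop := Relation.EqvGen QuasiIsoRel

/-- A cdga is formal if it is weakly equivalent to a cdga with zero differential;
equivalently, its minimal model admits a quasi-isomorphism onto its cohomology algebra
endowed with the zero differential.  A manifold is formal if its de Rham algebra is. -/
def CDGA.IsFormal (A : CDGA) : Prop :=
  ∃ B : CDGA, B.d = 0 ∧ WeakEquiv A B

end
noncomputable section

/-- The contraction (interior product) `ι_ξ` with a fixed vector field `ξ` on the de Rham
algebra, abstracted: a degree `-1` graded derivation squaring to zero. -/
structure Contraction (A : CDGA) where
  ι : A.carrier →ₗ[ℝ] A.carrier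
  ι_mem : ∀ {k : ℕ} {a : A.carrier}, a ∈ A.grading (k + 1) → ι a ∈ A.grading k
  ι_zero : ∀ a ∈ A.grading 0, ι a = 0
  ι_ι : ∀ a : A.carrier, ι (ι a) = 0
  ι_leibniz : ∀ {i : ℕ} {a : A.carrier}, a ∈ A.grading i → ∀ b : A.carrier,
    ι (a * b) = ι a * b + ((-1 : ℝ) ^ i) • (a * ι b)

namespace Contraction

variable {A : CDGA} (c : Contraction A)

/-- The Lie derivative `L_ξ` along the vector field, via Cartan's magic formula
`L_ξ = d ∘ ι_ξ + ι_ξ ∘ d`. -/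
def lie : A.carrier →ₗ[ℝ] A.carrier := A.d ∘ₗ c.ι + c.ι ∘ₗ A.d

/-- The `ξ`-invariant cocycles of degree `k`: closed degree-`k` elements killed by `L_ξ`. -/
def invCocycles (k : ℕ) : Submodule ℝ A.carrier :=
  A.cocycles k ⊓ LinearMap.ker c.lie

/-- The coboundaries of degree `k` of the complex `Ω^*_ξ` of `ξ`-invariant elements:
differentials of invariant elements of degree `k - 1`. -/
def invCoboundaries : ℕ → Submodule ℝ A.carrier
  | 0 => ⊥
  | k + 1 => Submodule.map A.d (A.grading k ⊓ LinearMap.ker c.lie) ⊓ A.grading (k + 1)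

end Contraction

end
namespace CDGA

variable {A : CDGA}

/-- Powers of a degree-two element `x` have even degree. -/
theorem pow_mem_grading_two {x : A.carrier} (hx : x ∈ A.grading 2) (m : ℕ) :
    x ^ m ∈ A.grading (2 * m) := by
  simpa [mul_comm] using SetLike.pow_mem_graded m hx

/-- The differential is linear over a closed element of degree two. -/
theorem d_pow_mul {x : A.carrier} (hx : x ∈ A.grading 2) (hdx : A.d x = 0) (m : ℕ)
    (b : A.carrier) : A.d (x ^ m * b) = x ^ m * A.d b := by
  induction m generalizing b with
  | zero => simp
  | succ m ih => rw [pow_succ, mul_assoc, ih, A.leibniz hx, hdx]; simp [mul_assoc]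

/-- The differential anticommutes with a closed element of degree one. -/
theorem d_mul_of_degree_one {x : A.carrier} (hx : x ∈ A.grading 1) (hdx : A.d x = 0)
    (b : A.carrier) : A.d (x * b) = -(x * A.d b) := by
  rw [A.leibniz hx, hdx]; simp

end CDGA

namespace Contraction

variable {A : CDGA} (c : Contraction A)

/-- The Lie derivative in terms of the differential and the contraction. -/
theorem lie_apply (a : A.carrier) : c.lie a = A.d (c.ι a) + c.ι (A.d a) := rfl

/-- Contraction is linear over a horizontal element of degree two. -/
theorem ι_pow_mul {x : A.carrier} (hx : x ∈ A.grading 2) (hιx : c.ι x = 0) (m : ℕ)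
    (b : A.carrier) : c.ι (x ^ m * b) = x ^ m * c.ι b := by
  induction m generalizing b with
  | zero => simp
  | succ m ih => rw [pow_succ, mul_assoc, ih, c.ι_leibniz hx, hιx]; simp [mul_assoc]

/-- Contracting a product with an element of degree one dual to the vector field. -/
theorem ι_mul_of_degree_one {x : A.carrier} (hx : x ∈ A.grading 1) (hιx : c.ι x = 1)
    (b : A.carrier) : c.ι (x * b) = b - x * c.ι b := by
  rw [c.ι_leibniz hx, hιx]; simp [sub_eq_add_neg]

/-- The Lie derivative is linear over a closed horizontal element of degree two. -/
theorem lie_pow_mul {x : A.carrier} (hx : x ∈ A.grading 2) (hdx : A.d x = 0)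
    (hιx : c.ι x = 0) (m : ℕ) (b : A.carrier) : c.lie (x ^ m * b) = x ^ m * c.lie b := by
  simp only [lie_apply, c.ι_pow_mul hx hιx, CDGA.d_pow_mul hx hdx, mul_add]

/-- The Lie derivative is linear over a closed element of degree one dual to the vector field. -/
theorem lie_mul_of_degree_one {x : A.carrier} (hx : x ∈ A.grading 1) (hdx : A.d x = 0)
    (hιx : c.ι x = 1) (b : A.carrier) : c.lie (x * b) = x * c.lie b := by
  simp only [lie_apply, c.ι_mul_of_degree_one hx hιx, CDGA.d_mul_of_degree_one hx hdx, map_sub,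
    map_neg, mul_add]
  abel

/-- The Lie derivative commutes with the contraction. -/
theorem lie_ι (a : A.carrier) : c.lie (c.ι a) = c.ι (c.lie a) := by
  simp [lie_apply, c.ι_ι]

end Contraction

/-- Let `(φ, η, ξ, g)` be a cosymplectic (almost coKähler) structure on a
manifold `M^{2n+1}` with Kähler form `ω`, so that `dη = 0 = dω`, `ι_ξ η = 1`, `ι_ξ ω = 0`
and `L_ξ η = 0 = L_ξ ω`.  For each `0 ≤ k ≤ n`, the Lefschetz map
`α ↦ ω^{n-k+1} ∧ ι_ξ α + ω^{n-k} ∧ η ∧ α` restricts to a map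
`L^{n-k} : Ω^k_ξ(M) → Ω^{2n+1-k}_ξ(M)` on `ξ`-invariant forms (its value on an invariant
`k`-form is an invariant `(2n+1-k)`-form), and this restricted map sends closed forms to
closed forms. -/
theorem cosymplectic_lefschetz_restricts_and_preserves_closed
    (n : ℕ) (A : CDGA) (c : Contraction A) (η ω : A.carrier)
    (hη : η ∈ A.grading 1) (hω : ω ∈ A.grading 2)
    (hdη : A.d η = 0) (hdω : A.d ω = 0)
    (hιη : c.ι η = 1) (hιω : c.ι ω = 0)
    (hLη : c.lie η = 0) (hLω : c.lie ω = 0)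
    (k : ℕ) (hk : k ≤ n)
    (α : A.carrier) (hα : α ∈ A.grading k) (hinv : c.lie α = 0) :
    (ω ^ (n - k + 1) * c.ι α + ω ^ (n - k) * (η * α)) ∈ A.grading (2 * n + 1 - k) ∧
    c.lie (ω ^ (n - k + 1) * c.ι α + ω ^ (n - k) * (η * α)) = 0 ∧
    (A.d α = 0 → A.d (ω ^ (n - k + 1) * c.ι α + ω ^ (n - k) * (η * α)) = 0) := by
  refine ⟨add_mem ?_ ?_, ?_, fun hdα => ?_⟩
  · cases k with
    | zero => simp [c.ι_zero α hα]
    | succ k =>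
      convert SetLike.mul_mem_graded (CDGA.pow_mem_grading_two hω (n - (k + 1) + 1))
        (c.ι_mem hα) using 2
      omega
  · convert SetLike.mul_mem_graded (CDGA.pow_mem_grading_two hω (n - k))
      (SetLike.mul_mem_graded hη hα) using 2
    omega
  · rw [map_add, c.lie_pow_mul hω hdω hιω, c.lie_pow_mul hω hdω hιω, c.lie_ι,
      c.lie_mul_of_degree_one hη hdη hιη, hinv]
    simp
  · have hdι : A.d (c.ι α) = 0 := by simpa [c.lie_apply, hdα] using hinv
    rw [map_add, CDGA.d_pow_mul hω hdω, CDGA.d_pow_mul hω hdω, CDGA.d_mul_of_degree_one hη hdη, hdα, hdι]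
    simp
end

section
/- Let (K^{2n}, h, ω) be a compact almost Kähler manifold and equip M = K × S¹ with its natural K-cosymplectic structure (with ξ tangent to S¹, η its dual 1-form, and the product metric). Then M satisfies the K-cosymplectic Lefschetz property (the maps L^{n-k}: H^k_ξ(M) → H^{2n+1-k}_ξ(M), α ↦ ω^{n-k+1} ∧ ι_ξ α + ω^{n-k} ∧ η ∧ α, are isomorphisms for all 0 ≤ k ≤ n) if and only if the symplectic manifold (K, ω) satisfies the Lefschetz property (the maps [α] ↦ [ω^{n-k} ∧ α]: H^k(K;ℝ) → H^{2n-k}(K;ℝ) are isomorphisms for all 0 ≤ k ≤ n). -/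
noncomputable section

/-- A K-cosymplectic structure (an almost coKähler structure `(φ, η, ξ, g)` whose Reeb field
`ξ` is Killing) on a compact manifold `M^{2n+1}`, recorded through its action on the de Rham
algebra `A = Ω^*(M)`: the contraction with the Reeb field, the closed forms `η` and `ω`
(the Kähler form), the almost contact relations `ι_ξ η = 1`, `ι_ξ ω = 0`, and the fact
(valid on a compact manifold since `ξ` is Killing) that the inclusion
`(Ω^*_ξ(M), d) ↪ (Ω^*(M), d)` of `ξ`-invariant forms is a quasi-isomorphism, so that
`H^*_ξ(M) ≅ H^*(M; ℝ)`. -/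
structure KCosymplecticOn (n : ℕ) (A : CDGA) where
  con : Contraction A
  η : A.carrier
  ω : A.carrier
  η_mem : η ∈ A.grading 1
  ω_mem : ω ∈ A.grading 2
  d_η : A.d η = 0
  d_ω : A.d ω = 0
  ι_η : con.ι η = 1
  ι_ω : con.ι ω = 0
  inv_qiso : ∀ k : ℕ,
    (∀ a ∈ con.invCocycles k, a ∈ A.coboundaries k → a ∈ con.invCoboundaries k) ∧
    (∀ b ∈ A.cocycles k, ∃ a ∈ con.invCocycles k, a - b ∈ A.coboundaries k)

namespace KCosymplecticOn

variable {n : ℕ} {A : CDGA} (S : KCosymplecticOn n A)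

/-- The cosymplectic Lefschetz map
`α ↦ ω^{n-k+1} ∧ ι_ξ α + ω^{n-k} ∧ η ∧ α` on degree-`k` forms. -/
def lefschetz (k : ℕ) (a : A.carrier) : A.carrier :=
  S.ω ^ (n - k + 1) * S.con.ι a + S.ω ^ (n - k) * (S.η * a)

/-- The Lefschetz map induces an isomorphism `H^k_ξ(M) → H^{2n+1-k}_ξ(M)` (stated
elementwise on the cohomology of the invariant complex). -/
def LefschetzIsoAt (k : ℕ) : Prop :=
  (∀ a ∈ S.con.invCocycles k,
      S.lefschetz k a ∈ S.con.invCoboundaries (2 * n + 1 - k) →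
        a ∈ S.con.invCoboundaries k) ∧
  (∀ b ∈ S.con.invCocycles (2 * n + 1 - k), ∃ a ∈ S.con.invCocycles k,
      S.lefschetz k a - b ∈ S.con.invCoboundaries (2 * n + 1 - k))

/-- The manifold is of Lefschetz type: the Lefschetz map is an isomorphism for `k = 1`. -/
def LefschetzType : Prop := S.LefschetzIsoAt 1

/-- The K-cosymplectic Lefschetz property: the Lefschetz map is an isomorphism
`H^k_ξ(M) → H^{2n+1-k}_ξ(M)` for all `0 ≤ k ≤ n`. -/
def Lefschetz : Prop := ∀ k ≤ n, S.LefschetzIsoAt k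

end KCosymplecticOn

/-- A compact manifold `M^{2n+1}` endowed with a K-cosymplectic structure, modeled by its
de Rham algebra.  Compactness (and the induced orientation) is recorded through the
finite-dimensionality of the cohomology, the non-exactness of the volume form `η ∧ ω^n`,
and Poincaré duality. -/
structure KCosymplectic (n : ℕ) where
  Ω : CDGA
  grading_top : ∀ k : ℕ, 2 * n + 1 < k → Ω.grading k = ⊥
  [findim : ∀ k : ℕ, FiniteDimensional ℝ (Ω.H k)]
  str : KCosymplecticOn n Ω
  vol : str.η * str.ω ^ n ∉ Ω.coboundaries (2 * n + 1)
  pd : ∀ k : ℕ, k ≤ 2 * n + 1 → ∀ a ∈ Ω.cocycles k, a ∉ Ω.coboundaries k →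
    ∃ b ∈ Ω.cocycles (2 * n + 1 - k), a * b ∉ Ω.coboundaries (2 * n + 1)

attribute [instance] KCosymplectic.findim

end
noncomputable section

/-- A compact symplectic manifold `(M^{2n}, ω)`: a compact topological space together with
its de Rham algebra `Ω^*(M)` and the (closed, non-degenerate) symplectic form `ω`.
Compactness, connectedness of components and orientability are recorded through their
cohomological consequences: finite-dimensional cohomology, the non-exactness of the
symplectic volume `ω^n` (Stokes), and Poincaré duality. -/
structure CompactSymplectic (n : ℕ) where
  space : Type
  [topology : TopologicalSpace space]
  [compact : CompactSpace space]
  Ω : CDGA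
  grading_top : ∀ k : ℕ, 2 * n < k → Ω.grading k = ⊥
  [findim : ∀ k : ℕ, FiniteDimensional ℝ (Ω.H k)]
  ω : Ω.carrier
  ω_mem : ω ∈ Ω.grading 2
  d_ω : Ω.d ω = 0
  vol : ω ^ n ∉ Ω.coboundaries (2 * n)
  pd : ∀ k : ℕ, k ≤ 2 * n → ∀ a ∈ Ω.cocycles k, a ∉ Ω.coboundaries k →
    ∃ b ∈ Ω.cocycles (2 * n - k), a * b ∉ Ω.coboundaries (2 * n)

attribute [instance] CompactSymplectic.topology CompactSymplectic.compact
  CompactSymplectic.findim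

namespace CompactSymplectic

variable {n : ℕ} (X : CompactSymplectic n)

/-- The (hard) Lefschetz property of a compact symplectic manifold: the Lefschetz map
`L^{n-k} : H^k(M;ℝ) → H^{2n-k}(M;ℝ)`, `[α] ↦ [ω^{n-k} ∧ α]`, is an isomorphism for all
`0 ≤ k ≤ n`. -/
def Lefschetz : Prop := ∀ k ≤ n, X.Ω.MulBijOn (X.ω ^ (n - k)) k (2 * n - k)

/-- Lefschetz type: the Lefschetz map `L^{n-1} : H^1(M;ℝ) → H^{2n-1}(M;ℝ)` is an
isomorphism. -/
def LefschetzType : Prop := X.Ω.MulBijOn (X.ω ^ (n - 1)) 1 (2 * n - 1)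

end CompactSymplectic

end
namespace KCosymplecticOn

variable {n : ℕ} {A B : CDGA} (S : KCosymplecticOn n B)

/-- `S.IsProductPullback j` says that `j` embeds `A` into the horizontal forms of `B`, and that
every invariant form splits as `j a₀ + η * j a₁`, as the pullback along `K × S¹ → K` does. -/
structure IsProductPullback (j : CDGAHom A B) : Prop where
  inj : Function.Injective j.toHom
  hor : ∀ a : A.carrier, S.con.ι (j.toHom a) = 0
  split : ∀ (k : ℕ) (a : B.carrier), a ∈ B.grading k → S.con.lie a = 0 →
    ∃ a0 ∈ A.grading k, ∃ a1 ∈ A.grading (k - 1), a = j.toHom a0 + S.η * j.toHom a1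

theorem η_mul_η : S.η * S.η = 0 := by
  have h := B.gcomm S.η_mem S.η_mem
  simp only [mul_one, pow_one, neg_smul, one_smul] at h
  have h2 : (2 : ℝ) • (S.η * S.η) = 0 := by
    rw [two_smul]
    nth_rewrite 1 [h]
    exact neg_add_cancel _
  exact (smul_eq_zero.mp h2).resolve_left two_ne_zero

theorem commute_ω_η : Commute S.ω S.η := by
  have h := B.gcomm S.ω_mem S.η_mem
  simpa [Commute, SemiconjBy] using h

theorem ι_η_mul (x : B.carrier) : S.con.ι (S.η * x) = x - S.η * S.con.ι x := by
  rw [S.con.ι_leibniz S.η_mem, S.ι_η]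
  simp [sub_eq_add_neg]

theorem d_η_mul (x : B.carrier) : B.d (S.η * x) = -(S.η * B.d x) := by
  rw [B.leibniz S.η_mem, S.d_η]
  simp

theorem η_mul_mem {k : ℕ} {x : B.carrier} (hx : x ∈ B.grading k) :
    S.η * x ∈ B.grading (k + 1) := by
  rw [add_comm]
  exact SetLike.mul_mem_graded S.η_mem hx

theorem d_split (j : CDGAHom A B) (a0 a1 : A.carrier) :
    B.d (j.toHom a0 + S.η * j.toHom a1) = j.toHom (A.d a0) + S.η * j.toHom (-A.d a1) := by
  rw [map_add, S.d_η_mul, j.map_d, map_neg, j.map_d, mul_neg]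

end KCosymplecticOn

theorem CDGA.d_mem_coboundaries (A : CDGA) {k : ℕ} {a : A.carrier} (ha : a ∈ A.grading k) :
    A.d a ∈ A.coboundaries (k + 1) :=
  ⟨⟨a, ha, rfl⟩, A.d_mem ha⟩

namespace KCosymplecticOn.IsProductPullback

variable {n : ℕ} {A B : CDGA} {S : KCosymplecticOn n B} {j : CDGAHom A B}

theorem ι_split (hj : S.IsProductPullback j) (a0 a1 : A.carrier) :
    S.con.ι (j.toHom a0 + S.η * j.toHom a1) = j.toHom a1 := by
  rw [map_add, S.ι_η_mul, hj.hor, hj.hor]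
  simp

theorem lie_split (hj : S.IsProductPullback j) (a0 a1 : A.carrier) :
    S.con.lie (j.toHom a0 + S.η * j.toHom a1) = 0 := by
  rw [Contraction.lie, LinearMap.add_apply, LinearMap.comp_apply, LinearMap.comp_apply,
    hj.ι_split, S.d_split, hj.ι_split, ← j.map_d, map_neg, add_neg_cancel]

theorem split_inj (hj : S.IsProductPullback j) {a0 a1 b0 b1 : A.carrier}
    (h : j.toHom a0 + S.η * j.toHom a1 = j.toHom b0 + S.η * j.toHom b1) :
    a0 = b0 ∧ a1 = b1 := by
  have h1 : a1 = b1 := hj.inj (by rw [← hj.ι_split a0 a1, h, hj.ι_split])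
  subst h1
  exact ⟨hj.inj (add_right_cancel h), rfl⟩

theorem split_zero (hj : S.IsProductPullback j) {a : B.carrier} (ha : a ∈ B.grading 0)
    (hl : S.con.lie a = 0) : ∃ a0 ∈ A.grading 0, a = j.toHom a0 := by
  obtain ⟨a0, h0, a1, h1, rfl⟩ := hj.split 0 a ha hl
  have hz : S.η * j.toHom a1 ∈ B.grading 0 := by
    simpa using (B.grading 0).sub_mem ha (j.map_grading 0 a0 h0)
  refine ⟨a0, h0, ?_⟩
  by_contra hne
  exact absurd (DirectSum.degree_eq_of_mem_mem B.grading hz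
    (S.η_mul_mem (j.map_grading 0 a1 h1)) fun h => hne (by rw [h, add_zero])) (by decide)

theorem split_mem_invCocycles (hj : S.IsProductPullback j) {k : ℕ} {a0 a1 : A.carrier}
    (h0 : a0 ∈ A.cocycles (k + 1)) (h1 : a1 ∈ A.cocycles k) :
    j.toHom a0 + S.η * j.toHom a1 ∈ S.con.invCocycles (k + 1) := by
  refine ⟨⟨add_mem (j.map_grading _ _ h0.1) (S.η_mul_mem (j.map_grading _ _ h1.1)), ?_⟩,
    hj.lie_split a0 a1⟩
  have e0 : A.d a0 = 0 := h0.2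
  have e1 : A.d a1 = 0 := h1.2
  rw [SetLike.mem_coe, LinearMap.mem_ker, S.d_split, e0, e1]
  simp

theorem exists_of_mem_invCocycles_succ (hj : S.IsProductPullback j) {k : ℕ} {a : B.carrier}
    (ha : a ∈ S.con.invCocycles (k + 1)) :
    ∃ a0 ∈ A.cocycles (k + 1), ∃ a1 ∈ A.cocycles k, a = j.toHom a0 + S.η * j.toHom a1 := by
  obtain ⟨⟨hk, hd⟩, hl⟩ := ha
  obtain ⟨a0, h0, a1, h1, rfl⟩ := hj.split _ a hk hl
  rw [SetLike.mem_coe, LinearMap.mem_ker, S.d_split] at hd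
  obtain ⟨e0, e1⟩ := hj.split_inj (b0 := 0) (b1 := 0) (hd.trans (by simp))
  exact ⟨a0, ⟨h0, e0⟩, a1, ⟨h1, neg_eq_zero.mp e1⟩, rfl⟩

theorem map_mem_invCocycles (hj : S.IsProductPullback j) {k : ℕ} {a : A.carrier}
    (ha : a ∈ A.cocycles k) : j.toHom a ∈ S.con.invCocycles k := by
  have e : A.d a = 0 := ha.2
  refine ⟨⟨j.map_grading _ _ ha.1, ?_⟩, ?_⟩
  · rw [SetLike.mem_coe, LinearMap.mem_ker, ← j.map_d, e, map_zero]
  · simpa using hj.lie_split a 0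

theorem exists_of_mem_invCocycles_zero (hj : S.IsProductPullback j) {a : B.carrier}
    (ha : a ∈ S.con.invCocycles 0) : ∃ a0 ∈ A.cocycles 0, a = j.toHom a0 := by
  obtain ⟨⟨hk, hd⟩, hl⟩ := ha
  obtain ⟨a0, h0, rfl⟩ := hj.split_zero hk hl
  rw [SetLike.mem_coe, LinearMap.mem_ker, ← j.map_d] at hd
  exact ⟨a0, ⟨h0, hj.inj (by simpa using hd)⟩, rfl⟩

theorem split_mem_invCoboundaries_iff (hj : S.IsProductPullback j) {k : ℕ}
    {a0 a1 : A.carrier} :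
    j.toHom a0 + S.η * j.toHom a1 ∈ S.con.invCoboundaries (k + 1) ↔
      a0 ∈ A.coboundaries (k + 1) ∧ a1 ∈ A.coboundaries k := by
  constructor
  · rintro ⟨⟨b, ⟨hb, hl⟩, hba⟩, -⟩
    cases k with
    | zero =>
      obtain ⟨b0, h0, rfl⟩ := hj.split_zero hb hl
      obtain ⟨rfl, rfl⟩ := hj.split_inj (b0 := A.d b0) (b1 := 0)
        (by rw [← hba, j.map_d]; simp)
      exact ⟨A.d_mem_coboundaries h0, zero_mem _⟩
    | succ k =>
      obtain ⟨b0, h0, b1, h1, rfl⟩ := hj.split _ b hb hl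
      rw [S.d_split] at hba
      obtain ⟨rfl, rfl⟩ := hj.split_inj hba
      exact ⟨A.d_mem_coboundaries h0, neg_mem (A.d_mem_coboundaries h1)⟩
  · rintro ⟨⟨⟨b0, h0, rfl⟩, -⟩, h1⟩
    cases k with
    | zero =>
      obtain rfl : a1 = 0 := h1
      refine ⟨⟨j.toHom b0, ⟨j.map_grading _ _ h0, ?_⟩, ?_⟩, ?_⟩
      · simpa using hj.lie_split b0 0
      · simp [j.map_d]
      · simpa using j.map_grading _ _ (A.d_mem h0)
    | succ k =>
      obtain ⟨⟨b1, h1, rfl⟩, -⟩ := h1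
      have hb : j.toHom b0 + S.η * j.toHom (-b1) ∈ B.grading (k + 1) :=
        add_mem (j.map_grading _ _ h0) (S.η_mul_mem (j.map_grading _ _ (neg_mem h1)))
      have hd : B.d (j.toHom b0 + S.η * j.toHom (-b1)) =
          j.toHom (A.d b0) + S.η * j.toHom (A.d b1) := by
        rw [S.d_split, map_neg A.d, neg_neg]
      exact ⟨⟨_, ⟨hb, hj.lie_split _ _⟩, hd⟩, hd ▸ B.d_mem hb⟩

theorem map_mem_invCoboundaries_zero_iff (hj : S.IsProductPullback j) {a : A.carrier} :
    j.toHom a ∈ S.con.invCoboundaries 0 ↔ a ∈ A.coboundaries 0 :=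
  map_eq_zero_iff j.toHom hj.inj

variable {w : A.carrier}

theorem lefschetz_split (hj : S.IsProductPullback j) (hw : j.toHom w = S.ω) (k : ℕ)
    (a0 a1 : A.carrier) :
    S.lefschetz k (j.toHom a0 + S.η * j.toHom a1) =
      j.toHom (w ^ (n - k + 1) * a1) + S.η * j.toHom (w ^ (n - k) * a0) := by
  rw [lefschetz, hj.ι_split, mul_add, ← mul_assoc S.η S.η, S.η_mul_η, zero_mul, add_zero,
    ← mul_assoc, (S.commute_ω_η.pow_left (n - k)).eq, mul_assoc, map_mul, map_mul, map_pow,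
    map_pow, hw]

theorem lefschetzIsoAt_zero_iff (hj : S.IsProductPullback j) (hw : j.toHom w = S.ω)
    (htop : A.grading (2 * n + 1) = ⊥) :
    S.LefschetzIsoAt 0 ↔ A.MulBijOn (w ^ n) 0 (2 * n) := by
  have hL (a : A.carrier) :
      S.lefschetz 0 (j.toHom a) = j.toHom 0 + S.η * j.toHom (w ^ n * a) := by
    simpa using hj.lefschetz_split hw 0 a 0
  have hsub (a b : A.carrier) : S.lefschetz 0 (j.toHom a) - (j.toHom 0 + S.η * j.toHom b) =
      j.toHom 0 + S.η * j.toHom (w ^ n * a - b) := by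
    rw [hL, map_sub, mul_sub, add_sub_add_left_eq_sub, map_zero, zero_add]
  constructor
  · rintro ⟨hi, hs⟩
    refine ⟨fun a ha h => ?_, fun b hb => ?_⟩
    · rw [← hj.map_mem_invCoboundaries_zero_iff]
      refine hi _ (hj.map_mem_invCocycles ha) ?_
      rw [hL]
      exact hj.split_mem_invCoboundaries_iff.mpr ⟨zero_mem _, h⟩
    · obtain ⟨a, ha, h⟩ := hs _ (hj.split_mem_invCocycles (zero_mem _) hb)
      obtain ⟨a, h0, rfl⟩ := hj.exists_of_mem_invCocycles_zero ha
      rw [hsub] at h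
      exact ⟨a, h0, (hj.split_mem_invCoboundaries_iff.mp h).2⟩
  · rintro ⟨hi, hs⟩
    refine ⟨fun a ha h => ?_, fun b hb => ?_⟩
    · obtain ⟨a, h0, rfl⟩ := hj.exists_of_mem_invCocycles_zero ha
      rw [hL] at h
      exact hj.map_mem_invCoboundaries_zero_iff.mpr
        (hi a h0 (hj.split_mem_invCoboundaries_iff.mp h).2)
    · obtain ⟨b0, h0, b1, h1, rfl⟩ := hj.exists_of_mem_invCocycles_succ hb
      obtain rfl : b0 = 0 := by simpa [htop] using h0.1
      obtain ⟨a, ha, h⟩ := hs b1 h1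
      refine ⟨_, hj.map_mem_invCocycles ha, ?_⟩
      rw [hsub]
      exact hj.split_mem_invCoboundaries_iff.mpr ⟨zero_mem _, h⟩

theorem lefschetzIsoAt_succ_iff (hj : S.IsProductPullback j) (hw : j.toHom w = S.ω) {k : ℕ}
    (hk : k + 1 ≤ n) :
    S.LefschetzIsoAt (k + 1) ↔
      A.MulBijOn (w ^ (n - (k + 1))) (k + 1) (2 * n - (k + 1)) ∧
        A.MulBijOn (w ^ (n - k)) k (2 * n - k) := by
  have hL := hj.lefschetz_split hw (k + 1)
  have hsub (a0 a1 b0 b1 : A.carrier) :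
      S.lefschetz (k + 1) (j.toHom a0 + S.η * j.toHom a1) - (j.toHom b0 + S.η * j.toHom b1) =
        j.toHom (w ^ (n - (k + 1) + 1) * a1 - b0) +
          S.η * j.toHom (w ^ (n - (k + 1)) * a0 - b1) := by
    rw [hL, map_sub, map_sub, mul_sub]; abel
  rw [LefschetzIsoAt, show 2 * n + 1 - (k + 1) = 2 * n - (k + 1) + 1 by omega,
    show 2 * n - k = 2 * n - (k + 1) + 1 by omega, show n - k = n - (k + 1) + 1 by omega]
  constructor
  · rintro ⟨hi, hs⟩
    refine ⟨⟨fun a ha h => ?_, fun b hb => ?_⟩, ⟨fun a ha h => ?_, fun b hb => ?_⟩⟩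
    · refine (hj.split_mem_invCoboundaries_iff.mp
        (hi _ (hj.split_mem_invCocycles ha (zero_mem _)) ?_)).1
      rw [hL, mul_zero]
      exact hj.split_mem_invCoboundaries_iff.mpr ⟨zero_mem _, h⟩
    · obtain ⟨a, ha, h⟩ := hs _ (hj.split_mem_invCocycles (zero_mem _) hb)
      obtain ⟨a0, h0, a1, h1, rfl⟩ := hj.exists_of_mem_invCocycles_succ ha
      rw [hsub] at h
      exact ⟨a0, h0, (hj.split_mem_invCoboundaries_iff.mp h).2⟩
    · refine (hj.split_mem_invCoboundaries_iff.mp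
        (hi _ (hj.split_mem_invCocycles (zero_mem _) ha) ?_)).2
      rw [hL, mul_zero]
      exact hj.split_mem_invCoboundaries_iff.mpr ⟨h, zero_mem _⟩
    · obtain ⟨a, ha, h⟩ := hs _ (hj.split_mem_invCocycles hb (zero_mem _))
      obtain ⟨a0, h0, a1, h1, rfl⟩ := hj.exists_of_mem_invCocycles_succ ha
      rw [hsub] at h
      exact ⟨a1, h1, (hj.split_mem_invCoboundaries_iff.mp h).1⟩
  · rintro ⟨⟨hi0, hs0⟩, ⟨hi1, hs1⟩⟩
    refine ⟨fun a ha h => ?_, fun b hb => ?_⟩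
    · obtain ⟨a0, h0, a1, h1, rfl⟩ := hj.exists_of_mem_invCocycles_succ ha
      rw [hL, hj.split_mem_invCoboundaries_iff] at h
      exact hj.split_mem_invCoboundaries_iff.mpr ⟨hi0 a0 h0 h.2, hi1 a1 h1 h.1⟩
    · obtain ⟨b0, h0, b1, h1, rfl⟩ := hj.exists_of_mem_invCocycles_succ hb
      obtain ⟨a0, ha0, e0⟩ := hs0 b1 h1
      obtain ⟨a1, ha1, e1⟩ := hs1 b0 h0
      refine ⟨_, hj.split_mem_invCocycles ha0 ha1, ?_⟩
      rw [hsub]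
      exact hj.split_mem_invCoboundaries_iff.mpr ⟨e1, e0⟩

end KCosymplecticOn.IsProductPullback

/-- Let `(K^{2n}, h, ω)` be a compact almost Kähler manifold and equip
`M = K × S¹` with its natural K-cosymplectic structure (`ξ` tangent to `S¹`, `η` its dual
`1`-form, product metric).  Then `M` satisfies the K-cosymplectic Lefschetz property if and
only if the symplectic manifold `(K, ω)` satisfies the Lefschetz property.

The product situation is recorded through the pullback map `j = pr_K^*` along the
projection `K × S¹ → K`: it is an injective map of de Rham algebras carrying `ω_K` to
`ω_M`, its image consists of horizontal (`ι_ξ ∘ j = 0`) invariant (`L_ξ ∘ j = 0`) forms,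
and every `ξ`-invariant `k`-form on `M` splits as `α = pr_K^* α₀ + η ∧ pr_K^* α₁`
(the splitting `H^k_ξ(M) = H^k(K;ℝ) ⊕ η ∧ H^{k-1}(K;ℝ)`). -/
theorem product_kcosymplectic_lefschetz_iff (n : ℕ)
    (K : CompactSymplectic n) (M : KCosymplectic n)
    (j : CDGAHom K.Ω M.Ω)
    (hj_inj : Function.Injective j.toHom)
    (hj_ω : j.toHom K.ω = M.str.ω)
    (hj_hor : ∀ a : K.Ω.carrier, M.str.con.ι (j.toHom a) = 0)
    (hj_inv : ∀ a : K.Ω.carrier, M.str.con.lie (j.toHom a) = 0)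
    (hsplit : ∀ (k : ℕ) (a : M.Ω.carrier), a ∈ M.Ω.grading k → M.str.con.lie a = 0 →
      ∃ a0 ∈ K.Ω.grading k, ∃ a1 ∈ K.Ω.grading (k - 1),
        a = j.toHom a0 + M.str.η * j.toHom a1) :
    M.str.Lefschetz ↔ K.Lefschetz := by
  have hj : M.str.IsProductPullback j := ⟨hj_inj, hj_hor, hsplit⟩
  have h_zero := hj.lefschetzIsoAt_zero_iff hj_ω (K.grading_top _ (Nat.lt_succ_self _))
  constructor
  · intro h k hk
    cases k with
    | zero => exact h_zero.mp (h 0 hk)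
    | succ k => exact ((hj.lefschetzIsoAt_succ_iff hj_ω hk).mp (h _ hk)).1
  · intro h k hk
    cases k with
    | zero => exact h_zero.mpr (h 0 hk)
    | succ k => exact (hj.lefschetzIsoAt_succ_iff hj_ω hk).mpr ⟨h _ hk, h k (by omega)⟩
end
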